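/- For all i, j ∈ I and all P ∈ U⁺, the skew differential operators satisfy the recurrences ∂_i(e_j P) = r^{−⟨α_j,α_i⟩} s^{⟨α_i,α_j⟩} e_j ∂_i(P) + δ_{ij} P and ∂_i'(e_j P) = r^{⟨α_i,α_j⟩} s^{−⟨α_j,α_i⟩} e_j ∂_i'(P) + δ_{ij} P. -/

import Mathlib

noncomputable section

/-- The q-integer `(m)_v = 1 + v + ⋯ + v^{m-1}`. -/
def qnat {K : Type} [CommRing K] (v : K) (m : ℕ) : K := ∑ i ∈ Finset.range m, v ^ i

/-- The Gaussian binomial coefficient `binom(m,k)_v`, as a polynomial expression in `v`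
(defined through the Pascal-type recurrence). -/
def qbinom {K : Type} [CommRing K] (v : K) : ℕ → ℕ → K
  | _, 0 => 1
  | 0, _ + 1 => 0
  | m + 1, k + 1 => qbinom v m k + v ^ (k + 1) * qbinom v m (k + 1)

/-- The Euler (Ringel) form on basis elements: `⟨α_i, α_j⟩ = d_i a_{ij}` if `i < j`,
`d_i` if `i = j`, and `0` if `i > j`. -/
def eulB {n : ℕ} (a : Fin n → Fin n → ℤ) (d : Fin n → ℤ) (i j : Fin n) : ℤ :=
  if i < j then d i * a i j else if i = j then d i else 0

/-- The Euler form on the root lattice `Q = Fin n → ℤ` (coordinates in the basis `α_i`). -/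
def euler {n : ℕ} (a : Fin n → Fin n → ℤ) (d : Fin n → ℤ) (μ ν : Fin n → ℤ) : ℤ :=
  ∑ i, ∑ j, μ i * ν j * eulB a d i j

/-- The coefficient `c^{(k)}_{ij} = (r_i s_i⁻¹)^{k(k-1)/2} r^{k⟨α_j,α_i⟩} s^{-k⟨α_i,α_j⟩}`. -/
def ccoef {K : Type} [Field K] {n : ℕ} (a : Fin n → Fin n → ℤ) (d : Fin n → ℤ)
    (r s : K) (i j : Fin n) (k : ℕ) : K :=
  (r ^ d i * (s ^ d i)⁻¹) ^ (k * (k - 1) / 2) *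
    r ^ ((k : ℤ) * eulB a d j i) * (s ^ ((k : ℤ) * eulB a d i j))⁻¹

/-- The `(r,s)`-Serre element
`∑_{k=0}^{1-a_{ij}} (-1)^k binom(1-a_{ij},k)_{r_i s_i⁻¹} c^{(k)}_{ij} E_i^{1-a_{ij}-k} E_j E_i^k`. -/
def serreElt {K : Type} [Field K] {n : ℕ} (a : Fin n → Fin n → ℤ) (d : Fin n → ℤ)
    (r s : K) {A : Type} [Ring A] [Algebra K A] (E : Fin n → A) (i j : Fin n) : A :=
  ∑ k ∈ Finset.range ((1 - a i j).toNat + 1),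
    ((-1 : K) ^ k * qbinom (r ^ d i * (s ^ d i)⁻¹) ((1 - a i j).toNat) k *
        ccoef a d r s i j k) •
      (E i ^ ((1 - a i j).toNat - k) * E j * E i ^ k)

/-- The defining relations of `U⁺_{r,s}`: the `(r,s)`-Serre relations. -/
inductive SerreRel (K : Type) [Field K] {n : ℕ} (a : Fin n → Fin n → ℤ) (d : Fin n → ℤ)
    (r s : K) : FreeAlgebra K (Fin n) → FreeAlgebra K (Fin n) → Prop
  | rel (i j : Fin n) (h : i ≠ j) :
      SerreRel K a d r s (serreElt a d r s (FreeAlgebra.ι K) i j) 0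

/-- `U⁺_{r,s}`: the algebra generated by the `e_i` subject only to the `(r,s)`-Serre
relations. -/
abbrev Uplus (K : Type) [Field K] {n : ℕ} (a : Fin n → Fin n → ℤ) (d : Fin n → ℤ)
    (r s : K) : Type := RingQuot (SerreRel K a d r s)

/-- The generator `e_i` of `U⁺_{r,s}`. -/
def eP (K : Type) [Field K] {n : ℕ} (a : Fin n → Fin n → ℤ) (d : Fin n → ℤ)
    (r s : K) (i : Fin n) : Uplus K a d r s :=
  RingQuot.mkAlgHom K (SerreRel K a d r s) (FreeAlgebra.ι K i)

/-- The degree-`μ` homogeneous component of `U⁺_{r,s}` for `μ ∈ Q⁺`: the span of the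
monomials in the `e_i` in which `e_i` occurs exactly `μ i` times. -/
def UplusDeg (K : Type) [Field K] {n : ℕ} (a : Fin n → Fin n → ℤ) (d : Fin n → ℤ)
    (r s : K) (μ : Fin n → ℕ) : Submodule K (Uplus K a d r s) :=
  Submodule.span K
    {x | ∃ w : List (Fin n), (∀ i, w.count i = μ i) ∧ x = (w.map (eP K a d r s)).prod}

/-- The `(r,s)`-Serre element for the negative generators:
`∑_{k=0}^{1-a_{ij}} (-1)^k binom(1-a_{ij},k)_{r_i s_i⁻¹} c^{(k)}_{ij} F_i^k F_j F_i^{1-a_{ij}-k}`. -/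
def serreEltF {K : Type} [Field K] {n : ℕ} (a : Fin n → Fin n → ℤ) (d : Fin n → ℤ)
    (r s : K) {A : Type} [Ring A] [Algebra K A] (F : Fin n → A) (i j : Fin n) : A :=
  ∑ k ∈ Finset.range ((1 - a i j).toNat + 1),
    ((-1 : K) ^ k * qbinom (r ^ d i * (s ^ d i)⁻¹) ((1 - a i j).toNat) k *
        ccoef a d r s i j k) •
      (F i ^ k * F j * F i ^ ((1 - a i j).toNat - k))

/-- The field `ℚ(r,s)` of rational functions in two variables over `ℚ`. -/
abbrev K2 : Type := FractionRing (MvPolynomial (Fin 2) ℚ)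

/-- The parameter `r ∈ ℚ(r,s)`. -/
def rr : K2 := algebraMap (MvPolynomial (Fin 2) ℚ) K2 (MvPolynomial.X 0)

/-- The parameter `s ∈ ℚ(r,s)`. -/
def ss : K2 := algebraMap (MvPolynomial (Fin 2) ℚ) K2 (MvPolynomial.X 1)

/-- Generators of the two-parameter quantum group `U_{r,s}(𝔤)`:
`e_i, f_i, ω_i^{±1}, ω_i'^{±1}`. -/
inductive Gen (n : ℕ) : Type
  | e (i : Fin n) : Gen n
  | f (i : Fin n) : Gen n
  | w (i : Fin n) : Gen n
  | winv (i : Fin n) : Gen n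
  | w' (i : Fin n) : Gen n
  | w'inv (i : Fin n) : Gen n

/-- The four toral generators `ω_i, ω_i^{-1}, ω_i', ω_i'^{-1}` attached to `i`. -/
def tor {n : ℕ} (i : Fin n) : Bool → Bool → Gen n
  | false, false => Gen.w i
  | false, true => Gen.winv i
  | true, false => Gen.w' i
  | true, true => Gen.w'inv i

/-- The defining relations (R1)–(R6) of the two-parameter quantum group `U_{r,s}(𝔤)`. -/
inductive URel {n : ℕ} (a : Fin n → Fin n → ℤ) (d : Fin n → ℤ) :
    FreeAlgebra K2 (Gen n) → FreeAlgebra K2 (Gen n) → Prop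
  | torComm (i j : Fin n) (p q p' q' : Bool) :
      URel a d (FreeAlgebra.ι K2 (tor i p q) * FreeAlgebra.ι K2 (tor j p' q'))
        (FreeAlgebra.ι K2 (tor j p' q') * FreeAlgebra.ι K2 (tor i p q))
  | wInvR (i : Fin n) :
      URel a d (FreeAlgebra.ι K2 (Gen.w i) * FreeAlgebra.ι K2 (Gen.winv i)) 1
  | wInvL (i : Fin n) :
      URel a d (FreeAlgebra.ι K2 (Gen.winv i) * FreeAlgebra.ι K2 (Gen.w i)) 1
  | w'InvR (i : Fin n) :
      URel a d (FreeAlgebra.ι K2 (Gen.w' i) * FreeAlgebra.ι K2 (Gen.w'inv i)) 1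
  | w'InvL (i : Fin n) :
      URel a d (FreeAlgebra.ι K2 (Gen.w'inv i) * FreeAlgebra.ι K2 (Gen.w' i)) 1
  | we (i j : Fin n) :
      URel a d (FreeAlgebra.ι K2 (Gen.w i) * FreeAlgebra.ι K2 (Gen.e j))
        ((rr ^ eulB a d j i * (ss ^ eulB a d i j)⁻¹) •
          (FreeAlgebra.ι K2 (Gen.e j) * FreeAlgebra.ι K2 (Gen.w i)))
  | w'e (i j : Fin n) :
      URel a d (FreeAlgebra.ι K2 (Gen.w' i) * FreeAlgebra.ι K2 (Gen.e j))
        (((rr ^ eulB a d i j)⁻¹ * ss ^ eulB a d j i) •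
          (FreeAlgebra.ι K2 (Gen.e j) * FreeAlgebra.ι K2 (Gen.w' i)))
  | wf (i j : Fin n) :
      URel a d (FreeAlgebra.ι K2 (Gen.w i) * FreeAlgebra.ι K2 (Gen.f j))
        (((rr ^ eulB a d j i)⁻¹ * ss ^ eulB a d i j) •
          (FreeAlgebra.ι K2 (Gen.f j) * FreeAlgebra.ι K2 (Gen.w i)))
  | w'f (i j : Fin n) :
      URel a d (FreeAlgebra.ι K2 (Gen.w' i) * FreeAlgebra.ι K2 (Gen.f j))
        ((rr ^ eulB a d i j * (ss ^ eulB a d j i)⁻¹) •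
          (FreeAlgebra.ι K2 (Gen.f j) * FreeAlgebra.ι K2 (Gen.w' i)))
  | ef (i j : Fin n) :
      URel a d
        (FreeAlgebra.ι K2 (Gen.e i) * FreeAlgebra.ι K2 (Gen.f j) -
          FreeAlgebra.ι K2 (Gen.f j) * FreeAlgebra.ι K2 (Gen.e i))
        (if i = j then
          ((rr ^ d i - ss ^ d i)⁻¹) •
            (FreeAlgebra.ι K2 (Gen.w i) - FreeAlgebra.ι K2 (Gen.w' i))
         else 0)
  | serreE (i j : Fin n) (h : i ≠ j) :
      URel a d (serreElt a d rr ss (fun k => FreeAlgebra.ι K2 (Gen.e k)) i j) 0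
  | serreF (i j : Fin n) (h : i ≠ j) :
      URel a d (serreEltF a d rr ss (fun k => FreeAlgebra.ι K2 (Gen.f k)) i j) 0

/-- The two-parameter quantum group `U_{r,s}(𝔤)` over `ℚ(r,s)`. -/
abbrev Uq {n : ℕ} (a : Fin n → Fin n → ℤ) (d : Fin n → ℤ) : Type :=
  RingQuot (URel a d)

/-- The image of a generator in `U_{r,s}(𝔤)`. -/
def gU {n : ℕ} (a : Fin n → Fin n → ℤ) (d : Fin n → ℤ) (x : Gen n) : Uq a d :=
  RingQuot.mkAlgHom K2 (URel a d) (FreeAlgebra.ι K2 x)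

/-- The subalgebra `U⁺` of `U_{r,s}(𝔤)` generated by the `e_i`. -/
def Upos {n : ℕ} (a : Fin n → Fin n → ℤ) (d : Fin n → ℤ) : Subalgebra K2 (Uq a d) :=
  Algebra.adjoin K2 (Set.range fun i => gU a d (Gen.e i))

/-- The subalgebra `U⁻` of `U_{r,s}(𝔤)` generated by the `f_i`. -/
def Uneg {n : ℕ} (a : Fin n → Fin n → ℤ) (d : Fin n → ℤ) : Subalgebra K2 (Uq a d) :=
  Algebra.adjoin K2 (Set.range fun i => gU a d (Gen.f i))

/-- The subalgebra `U⁰` of `U_{r,s}(𝔤)` generated by the `ω_i^{±1}, ω_i'^{±1}`. -/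
def Uzero {n : ℕ} (a : Fin n → Fin n → ℤ) (d : Fin n → ℤ) : Subalgebra K2 (Uq a d) :=
  Algebra.adjoin K2 (Set.range fun p : Fin n × Bool × Bool => gU a d (tor p.1 p.2.1 p.2.2))

/-- The generator `e_i` of `U⁺ ⊆ U_{r,s}(𝔤)`, as an element of the subalgebra `U⁺`. -/
def eUp {n : ℕ} (a : Fin n → Fin n → ℤ) (d : Fin n → ℤ) (i : Fin n) : ↥(Upos a d) :=
  ⟨gU a d (Gen.e i), Algebra.subset_adjoin (Set.mem_range_self i)⟩

section GaussianBinomial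

variable {K : Type}

lemma qnat_zero [CommRing K] (v : K) : qnat v 0 = 0 := by simp [qnat]

lemma qnat_succ [CommRing K] (v : K) (m : ℕ) : qnat v (m + 1) = qnat v m + v ^ m := by
  simp [qnat, Finset.sum_range_succ]

lemma qnat_add [CommRing K] (v : K) (k l : ℕ) :
    qnat v (k + l) = qnat v k + v ^ k * qnat v l := by
  simp [qnat, Finset.sum_range_add, Finset.mul_sum, pow_add]

lemma pow_mul_qnat_inv [Field K] {v : K} (hv : v ≠ 0) (m : ℕ) :
    v ^ m * qnat v⁻¹ (m + 1) = qnat v (m + 1) := by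
  rw [qnat, qnat, ← Finset.sum_range_reflect, Finset.mul_sum]
  refine Finset.sum_congr rfl fun i hi => ?_
  obtain ⟨j, rfl⟩ := Nat.exists_eq_add_of_le (Nat.lt_succ_iff.mp (Finset.mem_range.mp hi))
  rw [show i + j + 1 - 1 - i = j by omega, pow_add, inv_pow]
  field_simp

lemma qbinom_zero_right [CommRing K] (v : K) (m : ℕ) : qbinom v m 0 = 1 := by
  cases m <;> rfl

lemma qbinom_succ_succ [CommRing K] (v : K) (m k : ℕ) :
    qbinom v (m + 1) (k + 1) = qbinom v m k + v ^ (k + 1) * qbinom v m (k + 1) := rfl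

lemma qbinom_eq_zero [CommRing K] (v : K) {m k : ℕ} (h : m < k) : qbinom v m k = 0 := by
  induction m generalizing k with
  | zero => cases k with
    | zero => omega
    | succ k => rfl
  | succ m ih => cases k with
    | zero => omega
    | succ k => rw [qbinom_succ_succ, ih (by omega), ih (by omega)]; ring

lemma qbinom_succ_mul_qnat [CommRing K] (v : K) (k l : ℕ) :
    qbinom v (k + l) (k + 1) * qnat v (k + 1) = qbinom v (k + l) k * qnat v l := by
  obtain ⟨m, hm⟩ : ∃ m, m = k + l := ⟨_, rfl⟩
  induction m generalizing k l with
  | zero =>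
    obtain ⟨rfl, rfl⟩ : k = 0 ∧ l = 0 := by omega
    simp [qnat_zero, qbinom_eq_zero]
  | succ m ih =>
    have key : ∀ k l, m = k + l →
        qbinom v (m + 1) (k + 1) * qnat v (k + 1) = qbinom v m k * qnat v (m + 1) := by
      rintro k l rfl
      rw [qbinom_succ_succ, show k + l + 1 = (k + 1) + l by ring, qnat_add v (k + 1) l]
      linear_combination v ^ (k + 1) * ih k l rfl
    rw [← hm]
    rcases l with _ | l
    · rw [qbinom_eq_zero v (by omega), qnat_zero]; ring
    · rw [key k l (by omega)]
      rcases k with _ | k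
      · rw [qbinom_zero_right, qbinom_zero_right, show m + 1 = l + 1 by omega]
      · obtain rfl : m = (k + 1) + l := by omega
        have h := ih k (l + 1) (by omega)
        rw [show k + (l + 1) = k + 1 + l by ring] at h
        rw [qbinom_succ_succ, show k + 1 + l + 1 = (k + 1) + (l + 1) by ring, qnat_add v (k + 1)]
        linear_combination h

/-- The alternating Gaussian sum appearing in the `q`-binomial theorem. -/
def qbinomSum [CommRing K] (v z : K) (m : ℕ) : K :=
  ∑ k ∈ Finset.range (m + 1), (-1) ^ k * qbinom v m k * v ^ (k * (k - 1) / 2) * z ^ k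

lemma half_mul_pred_succ (k : ℕ) : (k + 1) * (k + 1 - 1) / 2 = k * (k - 1) / 2 + k := by
  rw [← Finset.sum_range_id_mul_two, ← Finset.sum_range_id_mul_two, Finset.sum_range_succ]
  omega

lemma qbinomSum_succ [CommRing K] (v z : K) (m : ℕ) :
    qbinomSum v z (m + 1) = (1 - z) * qbinomSum v (v * z) m := by
  have h1 : qbinomSum v (v * z) m = 1 + ∑ k ∈ Finset.range (m + 1),
      (-1) ^ (k + 1) * qbinom v m (k + 1) * v ^ ((k + 1) * (k + 1 - 1) / 2) *
        (v * z) ^ (k + 1) := by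
    rw [qbinomSum, Finset.sum_range_succ', Finset.sum_range_succ,
      qbinom_eq_zero v (Nat.lt_succ_self m)]
    simp [qbinom_zero_right, add_comm]
  have h2 : ∀ k, (-1) ^ (k + 1) * qbinom v (m + 1) (k + 1) * v ^ ((k + 1) * (k + 1 - 1) / 2) *
        z ^ (k + 1) =
      (-1) ^ (k + 1) * qbinom v m (k + 1) * v ^ ((k + 1) * (k + 1 - 1) / 2) * (v * z) ^ (k + 1) -
        z * ((-1) ^ k * qbinom v m k * v ^ (k * (k - 1) / 2) * (v * z) ^ k) := by
    intro k
    rw [qbinom_succ_succ, half_mul_pred_succ]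
    ring
  rw [sub_mul, one_mul, qbinomSum, Finset.sum_range_succ', Finset.sum_congr rfl fun k _ => h2 k,
    Finset.sum_sub_distrib, ← Finset.mul_sum, eq_sub_of_add_eq' h1.symm, qbinom_zero_right]
  simp only [qbinomSum, Nat.zero_mul, Nat.zero_div, pow_zero]
  ring

lemma qbinomSum_one [CommRing K] (v : K) (m : ℕ) : qbinomSum v 1 (m + 1) = 0 := by
  rw [qbinomSum_succ]; ring

lemma qbinomSum_inv_pow [Field K] {v : K} (hv : v ≠ 0) (m : ℕ) :
    qbinomSum v (v ^ m)⁻¹ (m + 1) = 0 := by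
  induction m with
  | zero => simpa using qbinomSum_one v 0
  | succ m ih =>
    rw [qbinomSum_succ, show v * (v ^ (m + 1))⁻¹ = (v ^ m)⁻¹ by rw [pow_succ]; field_simp, ih,
      mul_zero]

end GaussianBinomial

section Commutator

variable {K : Type} [Field K] {A : Type} [Ring A] [Algebra K A]

lemma mul_pow_of_mul_eq_smul {E W : A} {q : K} (hW : W * E = q • (E * W)) (m : ℕ) :
    W * E ^ m = q ^ m • (E ^ m * W) := by
  induction m with
  | zero => simp
  | succ m ih =>
    rw [pow_succ, ← mul_assoc, ih, smul_mul_assoc, mul_assoc, hW, mul_smul_comm, smul_smul,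
      mul_assoc, pow_succ]

lemma pow_succ_commutator {E G W W' : A} {q q' : K} (hG : E * G - G * E = W + W')
    (hW : W * E = q • (E * W)) (hW' : W' * E = q' • (E * W')) (m : ℕ) :
    E ^ (m + 1) * G - G * E ^ (m + 1) =
      qnat q (m + 1) • (E ^ m * W) + qnat q' (m + 1) • (E ^ m * W') := by
  induction m with
  | zero => simp [qnat, hG]
  | succ m ih =>
    have : E ^ (m + 2) * G - G * E ^ (m + 2) =
        E * (E ^ (m + 1) * G - G * E ^ (m + 1)) + (E * G - G * E) * E ^ (m + 1) := by
      rw [pow_succ' E (m + 1)]; noncomm_ring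
    rw [this, ih, hG, add_mul, mul_pow_of_mul_eq_smul hW,
      mul_pow_of_mul_eq_smul hW', qnat_succ q (m + 1), qnat_succ q' (m + 1)]
    simp only [mul_add, mul_smul_comm, ← mul_assoc, ← pow_succ', add_smul]
    abel

end Commutator

section Serre

variable {K : Type} [Field K] {n : ℕ}

/-- The scalar `r^{⟨α_j,α_i⟩} s^{-⟨α_i,α_j⟩}` by which `ω_i` commutes past `e_j`. -/
def wtE (a : Fin n → Fin n → ℤ) (d : Fin n → ℤ) (r s : K) (i j : Fin n) : K :=
  r ^ eulB a d j i * (s ^ eulB a d i j)⁻¹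

/-- The scalar `r^{-⟨α_i,α_j⟩} s^{⟨α_j,α_i⟩}` by which `ω_i'` commutes past `e_j`. -/
def wtE' (a : Fin n → Fin n → ℤ) (d : Fin n → ℤ) (r s : K) (i j : Fin n) : K :=
  (r ^ eulB a d i j)⁻¹ * s ^ eulB a d j i

lemma eulB_self (a : Fin n → Fin n → ℤ) (d : Fin n → ℤ) (i : Fin n) : eulB a d i i = d i := by
  simp [eulB]

lemma eulB_add_eulB {a : Fin n → Fin n → ℤ} {d : Fin n → ℤ}
    (hsym : ∀ i j, d i * a i j = d j * a j i) {i j : Fin n} (h : i ≠ j) :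
    eulB a d i j + eulB a d j i = d i * a i j := by
  rcases lt_or_gt_of_ne h with h' | h'
  · simp [eulB, h', h'.not_gt, h.symm]
  · simp [eulB, h', h'.not_gt, h, hsym i j]

variable {a : Fin n → Fin n → ℤ} {d : Fin n → ℤ} {r s : K}

lemma wtE_ne_zero (hr : r ≠ 0) (hs : s ≠ 0) (i j : Fin n) : wtE a d r s i j ≠ 0 :=
  mul_ne_zero (zpow_ne_zero _ hr) (inv_ne_zero (zpow_ne_zero _ hs))

lemma wtE'_ne_zero (hr : r ≠ 0) (hs : s ≠ 0) (i j : Fin n) : wtE' a d r s i j ≠ 0 :=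
  mul_ne_zero (inv_ne_zero (zpow_ne_zero _ hr)) (zpow_ne_zero _ hs)

lemma wtE_self (i : Fin n) : wtE a d r s i i = r ^ d i * (s ^ d i)⁻¹ := by
  rw [wtE, eulB_self]

lemma wtE'_self (i : Fin n) : wtE' a d r s i i = (r ^ d i * (s ^ d i)⁻¹)⁻¹ := by
  rw [wtE', eulB_self, mul_inv, inv_inv]

lemma wtE_mul_wtE'_swap (hr : r ≠ 0) (hs : s ≠ 0) (i j : Fin n) :
    wtE a d r s i j * wtE' a d r s j i = 1 := by
  have := zpow_ne_zero (eulB a d j i) hr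
  have := zpow_ne_zero (eulB a d i j) hs
  rw [wtE, wtE']
  field_simp

lemma wtE_swap_eq (hr : r ≠ 0) (hs : s ≠ 0) (hsym : ∀ i j, d i * a i j = d j * a j i)
    {i j : Fin n} (h : i ≠ j) {m : ℕ} (hm : a i j = -m) :
    wtE a d r s i j * (r ^ d i * (s ^ d i)⁻¹) ^ m = wtE' a d r s i j := by
  have h1 : eulB a d j i = -(d i * m) - eulB a d i j := by
    rw [← mul_neg, ← hm, ← eulB_add_eulB hsym h]; ring
  have := zpow_ne_zero (eulB a d i j) hr
  have := zpow_ne_zero (eulB a d i j) hs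
  rw [wtE, wtE', h1, zpow_sub₀ hr, zpow_sub₀ hs, zpow_neg, zpow_neg, zpow_mul, zpow_mul,
    zpow_natCast, zpow_natCast, mul_pow, inv_pow]
  have := pow_ne_zero m (zpow_ne_zero (d i) hr)
  have := pow_ne_zero m (zpow_ne_zero (d i) hs)
  field_simp

lemma ccoef_eq (i j : Fin n) (k : ℕ) :
    ccoef a d r s i j k =
      (r ^ d i * (s ^ d i)⁻¹) ^ (k * (k - 1) / 2) * wtE a d r s i j ^ k := by
  rw [ccoef, wtE, mul_comm (k : ℤ), mul_comm (k : ℤ), zpow_mul, zpow_mul, zpow_natCast,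
    zpow_natCast, mul_pow (r ^ eulB a d j i), inv_pow, mul_assoc]

variable {A : Type} [Ring A] [Algebra K A]

lemma map_serreElt {B : Type} [Ring B] [Algebra K B] (φ : A →ₐ[K] B) (E : Fin n → A)
    (i j : Fin n) :
    φ (serreElt a d r s E i j) = serreElt a d r s (fun k => φ (E k)) i j := by
  simp [serreElt]

lemma serreElt_smul (q : Fin n → K) (E : Fin n → A) (i j : Fin n) :
    serreElt a d r s (fun k => q k • E k) i j =
      (q i ^ (1 - a i j).toNat * q j) • serreElt a d r s E i j := by
  rw [serreElt, serreElt, Finset.smul_sum]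
  refine Finset.sum_congr rfl fun k hk => ?_
  obtain ⟨l, hl⟩ := Nat.exists_eq_add_of_le (Nat.lt_succ_iff.mp (Finset.mem_range.mp hk))
  simp only [smul_pow, smul_mul_assoc, mul_smul_comm, smul_smul]
  congr 1
  rw [hl, Nat.add_sub_cancel_left, pow_add]
  ring

/-- The family `E` has skew commutators with `G`, given by the pair of elements `W`, `W'` that
quasi-commute with `E` like `ω_i` and `ω_i'`; then `G` commutes with all Serre elements. -/
theorem commute_serreElt (hr : r ≠ 0) (hs : s ≠ 0) (hoff : ∀ i j, i ≠ j → a i j ≤ 0)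
    (hsym : ∀ i j, d i * a i j = d j * a j i) {E : Fin n → A} {G W W' : A} (l : Fin n)
    (hG : ∀ j, E j * G - G * E j = if l = j then W + W' else 0)
    (hW : ∀ j, W * E j = wtE a d r s l j • (E j * W))
    (hW' : ∀ j, W' * E j = wtE' a d r s l j • (E j * W'))
    {i j : Fin n} (h : i ≠ j) : Commute (serreElt a d r s E i j) G := by
  obtain ⟨M, hM⟩ : ∃ M : ℕ, a i j = -M := ⟨(-a i j).toNat, by have := hoff i j h; omega⟩
  have hm : (1 - a i j).toNat = M + 1 := by omega
  have hcomm : ∀ k, l ≠ k → Commute (E k) G := fun k hk => by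
    have := hG k
    rwa [if_neg hk, sub_eq_zero] at this
  set v := r ^ d i * (s ^ d i)⁻¹ with hv
  have hv0 : v ≠ 0 := mul_ne_zero (zpow_ne_zero _ hr) (inv_ne_zero (zpow_ne_zero _ hs))
  set p := wtE a d r s i j with hp
  set c : ℕ → K := fun k => (-1) ^ k * qbinom v (M + 1) k * (v ^ (k * (k - 1) / 2) * p ^ k) with hc
  have hS : serreElt a d r s E i j =
      ∑ k ∈ Finset.range (M + 2), c k • (E i ^ (M + 1 - k) * E j * E i ^ k) := by
    simp only [serreElt, hm, ccoef_eq, hc, ← hv, ← hp]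
  rw [hS]
  by_cases hlj : l = j
  · subst hlj
    have hi := hcomm i h.symm
    have hEl : E l * G - G * E l = W + W' := by simpa using hG l
    have term : ∀ k ∈ Finset.range (M + 2),
        (c k • (E i ^ (M + 1 - k) * E l * E i ^ k)) * G -
          G * (c k • (E i ^ (M + 1 - k) * E l * E i ^ k)) =
        ((-1) ^ k * qbinom v (M + 1) k * v ^ (k * (k - 1) / 2) * (p * wtE a d r s l i) ^ k) •
            (E i ^ (M + 1) * W) +
          ((-1) ^ k * qbinom v (M + 1) k * v ^ (k * (k - 1) / 2) * (p * wtE' a d r s l i) ^ k) •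
            (E i ^ (M + 1) * W') := by
      intro k hk
      obtain ⟨t, ht⟩ := Nat.exists_eq_add_of_le (Nat.lt_succ_iff.mp (Finset.mem_range.mp hk))
      have e1 : (E i ^ t * E l * E i ^ k) * G - G * (E i ^ t * E l * E i ^ k) =
          E i ^ t * (E l * G - G * E l) * E i ^ k := by
        have h1 := (hi.pow_left t).eq
        have h2 := (hi.pow_left k).eq
        calc _ = E i ^ t * E l * (E i ^ k * G) - (G * E i ^ t) * E l * E i ^ k := by noncomm_ring
          _ = _ := by rw [h2, ← h1]; noncomm_ring
      rw [smul_mul_assoc, mul_smul_comm, ← smul_sub, ht, Nat.add_sub_cancel_left, e1, hEl,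
        mul_add, add_mul, mul_assoc, mul_assoc, mul_pow_of_mul_eq_smul (hW i),
        mul_pow_of_mul_eq_smul (hW' i), mul_smul_comm, mul_smul_comm, ← mul_assoc, ← mul_assoc,
        ← pow_add, add_comm t k, smul_add, smul_smul, smul_smul, mul_pow, mul_pow, hc, ht]
      congr 2 <;> ring
    rw [Commute, SemiconjBy, ← sub_eq_zero, Finset.sum_mul, Finset.mul_sum,
      ← Finset.sum_sub_distrib, Finset.sum_congr rfl term, Finset.sum_add_distrib,
      ← Finset.sum_smul, ← Finset.sum_smul]
    have z1 : p * wtE a d r s l i = (v ^ M)⁻¹ := by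
      have h1 := wtE_swap_eq hr hs hsym h hM
      have h2 := wtE_mul_wtE'_swap (a := a) (d := d) hr hs l i
      rw [← h1] at h2
      refine eq_inv_of_mul_eq_one_left ?_
      linear_combination h2
    have z2 : p * wtE' a d r s l i = 1 := wtE_mul_wtE'_swap hr hs i l
    have s1 := qbinomSum_inv_pow hv0 M
    have s2 := qbinomSum_one v M
    rw [qbinomSum] at s1 s2
    rw [z1, z2, s1, s2, zero_smul, zero_smul, add_zero]
  by_cases hli : l = i
  · subst hli
    have hj := hcomm j hlj
    have hEl : E l * G - G * E l = W + W' := by simpa using hG l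
    have hpow := pow_succ_commutator hEl (hW l) (hW' l)
    rw [wtE_self, wtE'_self, ← hv] at hpow
    have split : ∀ k, (c k • (E l ^ (M + 1 - k) * E j * E l ^ k)) * G -
          G * (c k • (E l ^ (M + 1 - k) * E j * E l ^ k)) =
        c k • ((E l ^ (M + 1 - k) * G - G * E l ^ (M + 1 - k)) * E j * E l ^ k) +
          c k • (E l ^ (M + 1 - k) * E j * (E l ^ k * G - G * E l ^ k)) := by
      intro k
      rw [smul_mul_assoc, mul_smul_comm, ← smul_sub, ← smul_add]
      congr 1
      have h1 := hj.eq
      generalize E l ^ (M + 1 - k) = x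
      generalize E l ^ k = y
      have h2 : x * G * E j * y = x * E j * G * y := by rw [mul_assoc x, ← h1, ← mul_assoc]
      simp only [sub_mul, mul_sub, ← mul_assoc, h2]
      abel
    rw [Commute, SemiconjBy, ← sub_eq_zero, Finset.sum_mul, Finset.mul_sum,
      ← Finset.sum_sub_distrib, Finset.sum_congr rfl fun k _ => split k, Finset.sum_add_distrib,
      Finset.sum_range_succ, Finset.sum_range_succ' _ (M + 1)]
    simp only [Nat.sub_self, pow_zero, one_mul, mul_one, sub_self, zero_mul, mul_zero, smul_zero,
      add_zero]
    rw [← Finset.sum_add_distrib]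
    refine Finset.sum_eq_zero fun k hk => ?_
    obtain ⟨t, rfl⟩ := Nat.exists_eq_add_of_le (Nat.lt_succ_iff.mp (Finset.mem_range.mp hk))
    have hbin := qbinom_succ_mul_qnat v k (t + 1)
    have hc1 : c (k + 1) = -((-1) ^ k * qbinom v (k + t + 1) (k + 1) *
        (v ^ (k * (k - 1) / 2) * v ^ k * p ^ (k + 1))) := by
      simp only [hc, half_mul_pred_succ]; ring
    have c1 : c k * (qnat v (t + 1) * (p * v ^ k)) + c (k + 1) * qnat v (k + 1) = 0 := by
      rw [hc1, hc]
      linear_combination (-(-1) ^ k * v ^ (k * (k - 1) / 2) * v ^ k * p ^ (k + 1)) * hbin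
    have c2 : c k * (qnat v⁻¹ (t + 1) * (wtE' a d r s l j * v⁻¹ ^ k)) +
        c (k + 1) * qnat v⁻¹ (k + 1) = 0 := by
      have q1 := pow_mul_qnat_inv hv0 t
      have q2 := pow_mul_qnat_inv hv0 k
      have q3 : v ^ k * v⁻¹ ^ k = 1 := by rw [← mul_pow, mul_inv_cancel₀ hv0, one_pow]
      rw [← wtE_swap_eq hr hs hsym h hM, ← hv, ← hp, hc1, hc]
      rw [← q1, ← q2] at hbin
      rw [pow_add v k t]
      linear_combination (-(-1) ^ k * v ^ (k * (k - 1) / 2) * p ^ (k + 1)) * hbin +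
        ((-1) ^ k * qbinom v (k + t + 1) k * v ^ (k * (k - 1) / 2) * p ^ (k + 1) * v ^ t *
          qnat v⁻¹ (t + 1)) * q3
    have move : ∀ {V : A} {x y : K}, V * E j = x • (E j * V) → V * E l = y • (E l * V) →
        E l ^ t * V * E j * E l ^ k = (x * y ^ k) • (E l ^ t * E j * E l ^ k * V) := by
      intro V x y hx hy
      rw [mul_assoc (E l ^ t) V, hx, mul_smul_comm, smul_mul_assoc, ← mul_assoc,
        mul_assoc _ V, mul_pow_of_mul_eq_smul hy, mul_smul_comm, smul_smul, ← mul_assoc]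
    have m1 := move (hW j) (hW l)
    have m2 := move (hW' j) (hW' l)
    rw [wtE_self, ← hv] at m1
    rw [wtE'_self, ← hv] at m2
    rw [show k + t + 1 - k = t + 1 by omega, show k + t + 1 - (k + 1) = t by omega, hpow, hpow,
      add_mul, add_mul, mul_add, smul_mul_assoc, smul_mul_assoc, smul_mul_assoc, smul_mul_assoc,
      m1, m2, mul_smul_comm, mul_smul_comm, ← mul_assoc, ← mul_assoc]
    simp only [smul_add, smul_smul]
    rw [add_add_add_comm, ← add_smul, ← add_smul, ← hp, c1, c2,
      zero_smul, zero_smul, add_zero]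
  · refine Commute.sum_left _ _ _ fun k _ => Commute.smul_left ?_ _
    exact (((hcomm i hli).pow_left _).mul_left (hcomm j hlj)).mul_left ((hcomm i hli).pow_left _)

end Serre

section PositivePart

variable {K : Type} [Field K] {n : ℕ} {a : Fin n → Fin n → ℤ} {d : Fin n → ℤ} {r s : K}

lemma serreElt_intertwine {M N : Type} [AddCommGroup M] [Module K M] [AddCommGroup N] [Module K N]
    (T : M →ₗ[K] N) {E : Fin n → Module.End K M} {E' : Fin n → Module.End K N}
    (h : ∀ j x, T (E j x) = E' j (T x)) (i j : Fin n) (x : M) :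
    T (serreElt a d r s E i j x) = serreElt a d r s E' i j (T x) := by
  have hpow : ∀ (j : Fin n) (k : ℕ) (x : M), T ((E j ^ k) x) = (E' j ^ k) (T x) := by
    intro j k
    induction k with
    | zero => simp
    | succ k ih => intro x; rw [pow_succ, pow_succ, Module.End.mul_apply, ih, h]; rfl
  simp only [serreElt, LinearMap.sum_apply, map_sum, LinearMap.smul_apply, map_smul,
    Module.End.mul_apply, hpow, h]

lemma serreElt_mulLeft {A : Type} [Ring A] [Algebra K A] (E : Fin n → A) (i j : Fin n) :
    serreElt a d r s (fun k => LinearMap.mulLeft K (E k)) i j =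
      LinearMap.mulLeft K (serreElt a d r s E i j) :=
  (map_serreElt (Algebra.lmul K A) E i j).symm

lemma serreElt_eP {i j : Fin n} (h : i ≠ j) : serreElt a d r s (eP K a d r s) i j = 0 := by
  have := RingQuot.mkAlgHom_rel K (SerreRel.rel (K := K) (a := a) (d := d) (r := r) (s := s) i j h)
  rwa [map_serreElt, map_zero] at this

/-- The universal property of `U⁺_{r,s}`. -/
def uplusLift {A : Type} [Ring A] [Algebra K A] (E : Fin n → A)
    (hE : ∀ i j, i ≠ j → serreElt a d r s E i j = 0) : Uplus K a d r s →ₐ[K] A :=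
  RingQuot.liftAlgHom K ⟨FreeAlgebra.lift K E, by
    rintro _ _ ⟨i, j, h⟩
    rw [map_serreElt, map_zero, ← hE i j h]
    simp⟩

@[simp]
lemma uplusLift_eP {A : Type} [Ring A] [Algebra K A] (E : Fin n → A)
    (hE : ∀ i j, i ≠ j → serreElt a d r s E i j = 0) (j : Fin n) :
    uplusLift E hE (eP K a d r s j) = E j := by
  rw [uplusLift, eP, RingQuot.liftAlgHom_mkAlgHom_apply, FreeAlgebra.lift_ι_apply]

lemma uplus_hom_ext {M : Type} [AddCommGroup M] [Module K M] {f g : Uplus K a d r s →ₗ[K] M}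
    (h1 : f 1 = g 1)
    (h : ∀ j P, f P = g P → f (eP K a d r s j * P) = g (eP K a d r s j * P)) : f = g := by
  have key : ∀ x : FreeAlgebra K (Fin n), ∀ P ∈ LinearMap.eqLocus f g,
      RingQuot.mkAlgHom K (SerreRel K a d r s) x * P ∈ LinearMap.eqLocus f g := by
    intro x
    induction x using FreeAlgebra.induction with
    | grade0 t =>
      intro P hP
      rw [AlgHom.commutes, ← Algebra.smul_def]
      exact Submodule.smul_mem _ _ hP
    | grade1 j => exact fun P hP => h j P hP
    | mul x y hx hy =>
      intro P hP
      rw [map_mul, mul_assoc]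
      exact hx _ (hy _ hP)
    | add x y hx hy =>
      intro P hP
      rw [map_add, add_mul]
      exact add_mem (hx P hP) (hy P hP)
  ext P
  obtain ⟨x, rfl⟩ := RingQuot.mkAlgHom_surjective K (SerreRel K a d r s) P
  simpa using key x 1 h1

/-- The endomorphism of `U⁺_{r,s}` rescaling each generator `e_j` by `q j`. -/
def uplusScale (q : Fin n → K) : Uplus K a d r s →ₐ[K] Uplus K a d r s :=
  uplusLift (fun j => q j • eP K a d r s j) fun i j h => by
    rw [serreElt_smul, serreElt_eP h, smul_zero]

@[simp]
lemma uplusScale_eP (q : Fin n → K) (j : Fin n) :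
    uplusScale q (eP K a d r s j) = q j • eP K a d r s j := uplusLift_eP _ _ j

lemma uplusScale_uplusScale (q q' : Fin n → K) (P : Uplus K a d r s) :
    uplusScale q (uplusScale q' P) = uplusScale (q * q') P := by
  refine LinearMap.congr_fun (f := (uplusScale q).toLinearMap ∘ₗ (uplusScale q').toLinearMap)
    (g := (uplusScale (q * q')).toLinearMap) (uplus_hom_ext (by simp) fun j P hP => ?_) P
  simp only [LinearMap.comp_apply, AlgHom.toLinearMap_apply] at hP ⊢
  simp [hP, smul_smul, mul_comm]

lemma uplusScale_one (P : Uplus K a d r s) : uplusScale 1 P = P := by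
  refine LinearMap.congr_fun (f := (uplusScale 1).toLinearMap)
    (g := LinearMap.id) (uplus_hom_ext (by simp) fun j P hP => ?_) P
  simp only [LinearMap.id_apply, AlgHom.toLinearMap_apply] at hP ⊢
  simp [hP]

lemma exists_skew_derivation (hr : r ≠ 0) (hs : s ≠ 0) (hoff : ∀ i j, i ≠ j → a i j ≤ 0)
    (hsym : ∀ i j, d i * a i j = d j * a j i) (l : Fin n) {q : Fin n → K}
    (hq : q = wtE a d r s l ∨ q = wtE' a d r s l) :
    ∃ f : Module.End K (Uplus K a d r s), f 1 = 0 ∧ ∀ j P,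
      f (eP K a d r s j * P) = eP K a d r s j * f P + if l = j then uplusScale q P else 0 := by
  let B := Uplus K a d r s
  let e : Fin n → B := eP K a d r s
  let E : Fin n → Module.End K (B × B) := fun j =>
    ((LinearMap.mulLeft K (e j)).prodMap (q j • LinearMap.mulLeft K (e j))) +
      if l = j then LinearMap.inl K B B ∘ₗ LinearMap.snd K B B else 0
  have hE : ∀ j x y, E j (x, y) = (e j * x + if l = j then y else 0, q j • (e j * y)) := by
    intro j x y
    by_cases h : l = j <;> simp [E, h]
  let G : Module.End K (B × B) := LinearMap.inl K B B ∘ₗ LinearMap.fst K B B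
  let W : Module.End K (B × B) := -(LinearMap.inl K B B ∘ₗ LinearMap.snd K B B)
  have hEG : ∀ j, E j * G - G * E j = if l = j then W else 0 := by
    intro j
    refine LinearMap.ext fun ⟨x, y⟩ => ?_
    by_cases h : l = j <;> simp [hE, G, W, h]
  have hWE : ∀ j, W * E j = q j • (E j * W) := by
    intro j
    refine LinearMap.ext fun ⟨x, y⟩ => ?_
    simp [hE, W, mul_neg (e j) y]
  have hcomm : ∀ i j, i ≠ j → Commute (serreElt a d r s E i j) G := by
    intro i j h
    rcases hq with rfl | rfl
    · exact commute_serreElt hr hs hoff hsym (W := W) (W' := 0) l (by simpa using hEG) hWE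
        (by simp) h
    · exact commute_serreElt hr hs hoff hsym (W := 0) (W' := W) l (by simpa using hEG) (by simp)
        hWE h
  have hmul : ∀ i j, i ≠ j → serreElt a d r s (fun k => LinearMap.mulLeft K (e k)) i j = 0 := by
    intro i j h
    rw [serreElt_mulLeft, serreElt_eP h, LinearMap.mulLeft_zero_eq_zero]
  have hserre : ∀ i j, i ≠ j → serreElt a d r s E i j = 0 := by
    intro i j h
    have h1 : ∀ x : B, serreElt a d r s E i j (x, 0) = 0 := by
      intro x
      have := serreElt_intertwine (a := a) (d := d) (r := r) (s := s) (LinearMap.inl K B B)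
        (E := fun k => LinearMap.mulLeft K (e k)) (E' := E) (by simp [hE]) i j x
      rw [hmul i j h] at this
      exact this.symm
    have h2 : ∀ y : B, serreElt a d r s E i j (0, y) = 0 := by
      intro y
      refine Prod.ext ?_ ?_
      · have := LinearMap.congr_fun (hcomm i j h).eq (0, y)
        have hG : G (0, y) = 0 := by simp [G]
        rw [Module.End.mul_apply, Module.End.mul_apply, hG, map_zero] at this
        exact (congrArg Prod.fst this).symm
      · have := serreElt_intertwine (a := a) (d := d) (r := r) (s := s) (LinearMap.snd K B B)
          (E := E) (E' := fun k => q k • LinearMap.mulLeft K (e k))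
          (fun j x => by rw [← Prod.mk.eta (p := x), hE]; simp) i j (0, y)
        rw [serreElt_smul, hmul i j h] at this
        simpa using this
    refine LinearMap.ext fun ⟨x, y⟩ => ?_
    have : ((x, y) : B × B) = (x, 0) + (0, y) := by simp
    rw [this, map_add, h1, h2]
    simp
  let Φ := uplusLift E hserre
  let ev : B →ₗ[K] B × B := LinearMap.applyₗ ((0, 1) : B × B) ∘ₗ Φ.toLinearMap
  have hev : ∀ P, ev P = Φ P (0, 1) := fun P => rfl
  have hstep : ∀ j P, ev (e j * P) = E j (ev P) := by
    intro j P
    rw [hev, hev, map_mul, uplusLift_eP]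
    rfl
  have hsnd : LinearMap.snd K B B ∘ₗ ev = (uplusScale q).toLinearMap := by
    refine uplus_hom_ext (by simp [hev]) fun j P hP => ?_
    simp only [LinearMap.comp_apply, AlgHom.toLinearMap_apply] at hP ⊢
    rw [hstep, ← Prod.mk.eta (p := ev P), hE, map_mul, ← hP]
    simp [e]
  refine ⟨LinearMap.fst K B B ∘ₗ ev, by simp [hev], fun j P => ?_⟩
  have h2 := LinearMap.congr_fun hsnd P
  simp only [LinearMap.comp_apply, AlgHom.toLinearMap_apply] at h2 ⊢
  rw [← h2, hstep, ← Prod.mk.eta (p := ev P), hE]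
  rfl

end PositivePart

section LowestWeight

variable {K : Type} [Field K] {r s : K} {n : ℕ} {a : Fin n → Fin n → ℤ} {d : Fin n → ℤ}

lemma inv_wtE (i j : Fin n) :
    (wtE a d r s i j)⁻¹ = (r ^ eulB a d j i)⁻¹ * s ^ eulB a d i j := by
  rw [wtE, mul_inv, inv_inv]

lemma inv_wtE' (i j : Fin n) :
    (wtE' a d r s i j)⁻¹ = r ^ eulB a d i j * (s ^ eulB a d j i)⁻¹ := by
  rw [wtE', mul_inv, inv_inv]

lemma serreElt_op {A : Type} [Ring A] [Algebra K A]
    (F : Fin n → A) (i j : Fin n) :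
    serreElt a d r s (fun k => MulOpposite.op (F k)) i j =
      MulOpposite.op (serreEltF a d r s F i j) := by
  simp [serreElt, serreEltF, mul_assoc]

lemma serreEltF_apply_eq_zero {M : Type} [AddCommGroup M]
    [Module K M] {F : Fin n → Module.End K M} {x : M} (hF : ∀ k, F k x = 0) (i j : Fin n) :
    serreEltF a d r s F i j x = 0 := by
  rw [serreEltF, LinearMap.sum_apply]
  refine Finset.sum_eq_zero fun k _ => ?_
  rcases (1 - a i j).toNat - k with _ | m
  · simp [hF]
  · simp [pow_succ, hF]

/-- The action of the generators of `U_{r,s}(𝔤)` on the lowest weight module `U⁺_{r,s}`, given the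
operators `f` by which the `f_i` act; `ω_i` has eigenvalue `t` on the lowest weight vector. -/
def genAction (t : K) (f : Fin n → Module.End K (Uplus K a d r s)) :
    Gen n → Module.End K (Uplus K a d r s)
  | .e j => LinearMap.mulLeft K (eP K a d r s j)
  | .f j => f j
  | .w i => t • (uplusScale (wtE a d r s i)).toLinearMap
  | .winv i => t⁻¹ • (uplusScale (wtE a d r s i)⁻¹).toLinearMap
  | .w' i => (uplusScale (wtE' a d r s i)).toLinearMap
  | .w'inv i => (uplusScale (wtE' a d r s i)⁻¹).toLinearMap

lemma uplusScale_mul_uplusScale (q q' : Fin n → K) :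
    ((uplusScale q).toLinearMap * (uplusScale q').toLinearMap :
      Module.End K (Uplus K a d r s)) = (uplusScale (q * q')).toLinearMap :=
  LinearMap.ext fun P => uplusScale_uplusScale q q' P

lemma uplusScale_one_toLinearMap :
    ((uplusScale 1).toLinearMap : Module.End K (Uplus K a d r s)) = 1 :=
  LinearMap.ext fun P => uplusScale_one P

lemma uplusScale_mul_mulLeft (q : Fin n → K) (j : Fin n) :
    ((uplusScale q).toLinearMap * LinearMap.mulLeft K (eP K a d r s j) :
      Module.End K (Uplus K a d r s)) =
      q j • (LinearMap.mulLeft K (eP K a d r s j) * (uplusScale q).toLinearMap) :=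
  LinearMap.ext fun P => by simp

lemma uplusScale_skew_derivation {q q₀ : Fin n → K} {l : Fin n}
    {f : Module.End K (Uplus K a d r s)} (h1 : f 1 = 0)
    (h : ∀ j P, f (eP K a d r s j * P) =
      eP K a d r s j * f P + if l = j then uplusScale q₀ P else 0) :
    f * (uplusScale q).toLinearMap = q l • ((uplusScale q).toLinearMap * f) := by
  refine uplus_hom_ext (by simp [h1]) fun j P hP => ?_
  simp only [LinearMap.smul_apply, Module.End.mul_apply, AlgHom.toLinearMap_apply] at hP ⊢
  rw [map_mul, uplusScale_eP, smul_mul_assoc, map_smul, h, h, hP, map_add, map_mul, uplusScale_eP,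
    smul_add, smul_add, mul_smul_comm, smul_mul_assoc, smul_comm (q j)]
  congr 1
  by_cases hl : l = j
  · subst hl
    rw [if_pos rfl, if_pos rfl, uplusScale_uplusScale, uplusScale_uplusScale, mul_comm]
  · simp [hl]

lemma exists_lowering (hr : r ≠ 0) (hs : s ≠ 0) (hoff : ∀ i j, i ≠ j → a i j ≤ 0)
    (hsym : ∀ i j, d i * a i j = d j * a j i) (t : K) :
    ∃ f : Fin n → Module.End K (Uplus K a d r s), (∀ i, f i 1 = 0) ∧
      (∀ i q, f i * (uplusScale q).toLinearMap = q i • ((uplusScale q).toLinearMap * f i)) ∧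
      ∀ i j, genAction t f (.e i) * f j - f j * genAction t f (.e i) =
        if i = j then (r ^ d i - s ^ d i)⁻¹ • (genAction t f (.w i) - genAction t f (.w' i))
        else 0 := by
  choose g g1 hg using fun l =>
    exists_skew_derivation hr hs hoff hsym l (q := wtE a d r s l) (.inl rfl)
  choose g' g1' hg' using fun l =>
    exists_skew_derivation hr hs hoff hsym l (q := wtE' a d r s l) (.inr rfl)
  refine ⟨fun i => (r ^ d i - s ^ d i)⁻¹ • (g' i - t • g i), fun i => by simp [g1, g1'],
    fun i q => ?_, fun i j => LinearMap.ext fun P => ?_⟩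
  · refine LinearMap.ext fun P => ?_
    have h := LinearMap.congr_fun (uplusScale_skew_derivation (q := q) (g1 i) (hg i)) P
    have h' := LinearMap.congr_fun (uplusScale_skew_derivation (q := q) (g1' i) (hg' i)) P
    simp only [Module.End.mul_apply, LinearMap.smul_apply, LinearMap.sub_apply, map_smul,
      map_sub, AlgHom.toLinearMap_apply] at h h' ⊢
    rw [h, h']
    module
  · simp only [genAction, LinearMap.sub_apply, Module.End.mul_apply, LinearMap.mulLeft_apply,
      LinearMap.smul_apply, hg, hg', mul_smul_comm, mul_sub]
    by_cases h : i = j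
    · subst h
      simp only [if_true, LinearMap.smul_apply, LinearMap.sub_apply, AlgHom.toLinearMap_apply]
      module
    · simp only [h, Ne.symm h, if_false, LinearMap.zero_apply]
      module

lemma serreEltF_eq_zero_of_lowering (hr : r ≠ 0) (hs : s ≠ 0) (hoff : ∀ i j, i ≠ j → a i j ≤ 0)
    (hsym : ∀ i j, d i * a i j = d j * a j i) {t : K}
    {f : Fin n → Module.End K (Uplus K a d r s)} (f1 : ∀ i, f i 1 = 0)
    (hfS : ∀ i q, f i * (uplusScale q).toLinearMap = q i • ((uplusScale q).toLinearMap * f i))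
    (hef : ∀ i j, genAction t f (.e i) * f j - f j * genAction t f (.e i) =
        if i = j then (r ^ d i - s ^ d i)⁻¹ • (genAction t f (.w i) - genAction t f (.w' i))
        else 0)
    {i j : Fin n} (h : i ≠ j) : serreEltF a d r s f i j = 0 := by
  have hfw : ∀ i j, f j * genAction t f (.w i) =
      wtE a d r s i j • (genAction t f (.w i) * f j) := by
    intro i j
    rw [genAction, mul_smul_comm, hfS, smul_mul_assoc, smul_comm]
  have hfw' : ∀ i j, f j * genAction t f (.w' i) =
      wtE' a d r s i j • (genAction t f (.w' i) * f j) := fun i j => hfS j _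
  refine uplus_hom_ext (by rw [serreEltF_apply_eq_zero f1, LinearMap.zero_apply])
    fun k P hP => ?_
  have hc : Commute (serreElt a d r s (fun k => MulOpposite.op (f k)) i j)
      (MulOpposite.op (genAction t f (.e k))) := by
    refine commute_serreElt hr hs hoff hsym
      (W := MulOpposite.op ((r ^ d k - s ^ d k)⁻¹ • genAction t f (.w k)))
      (W' := MulOpposite.op (-(r ^ d k - s ^ d k)⁻¹ • genAction t f (.w' k))) k
      (fun l => ?_) (fun l => ?_) (fun l => ?_) h
    · rw [← MulOpposite.op_mul, ← MulOpposite.op_mul, ← MulOpposite.op_sub, hef]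
      split_ifs
      · rw [← MulOpposite.op_add]
        refine congrArg MulOpposite.op (LinearMap.ext fun P => ?_)
        simp only [LinearMap.smul_apply, LinearMap.sub_apply, LinearMap.add_apply]
        module
      · exact MulOpposite.op_zero
    · rw [← MulOpposite.op_mul, ← MulOpposite.op_mul, ← MulOpposite.op_smul, mul_smul_comm,
        hfw, smul_mul_assoc, smul_comm]
    · rw [← MulOpposite.op_mul, ← MulOpposite.op_mul, ← MulOpposite.op_smul, mul_smul_comm,
        hfw', smul_mul_assoc, smul_comm]
  rw [serreElt_op] at hc
  have := LinearMap.congr_fun (MulOpposite.op_injective hc.eq) P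
  have h2 : eP K a d r s k * serreEltF a d r s f i j P =
      serreEltF a d r s f i j (eP K a d r s k * P) := this
  rw [← h2, hP, LinearMap.zero_apply, mul_zero, LinearMap.zero_apply]

/-- Left multiplication by a quasi-commuting element `e` preserves relations of the form
`c [P, F] = W x - W' x'`. -/
lemma skew_commutator_mul {U : Type} [Ring U] [Algebra K U] {W W' F e P Q V x x' y y' : U}
    {c p p' : K} (hp : p ≠ 0) (hp' : p' ≠ 0) (hWe : W * e = p • (e * W))
    (hWe' : W' * e = p' • (e * W')) (hef : c • (e * F - F * e) = V)
    (hV : V * P = W * Q - W' * Q) (hP : c • (P * F - F * P) = W * x - W' * x')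
    (heP : c • (e * P * F - F * (e * P)) = W * y - W' * y') :
    W * (y - (p⁻¹ • (e * x) + Q)) = W' * (y' - (p'⁻¹ • (e * x') + Q)) := by
  have h1 : c • (e * P * F - F * (e * P)) =
      e * (c • (P * F - F * P)) + (c • (e * F - F * e)) * P := by
    rw [mul_smul_comm, smul_mul_assoc, ← smul_add]
    congr 1
    noncomm_ring
  rw [heP, hP, hef, hV, mul_sub, ← mul_assoc, ← mul_assoc,
    (eq_inv_smul_iff₀ hp).mpr hWe.symm, (eq_inv_smul_iff₀ hp').mpr hWe'.symm, smul_mul_assoc,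
    smul_mul_assoc, mul_assoc, mul_assoc, ← sub_eq_zero] at h1
  rw [mul_sub, mul_sub, mul_add, mul_add, mul_smul_comm, mul_smul_comm, ← sub_eq_zero, ← h1]
  abel

end LowestWeight

section Representation

variable {n : ℕ} {a : Fin n → Fin n → ℤ} {d : Fin n → ℤ}

lemma rr_ne_zero : rr ≠ 0 := by
  simp [rr, MvPolynomial.X_ne_zero]

lemma ss_ne_zero : ss ≠ 0 := by
  simp [ss, MvPolynomial.X_ne_zero]

lemma rr_zpow_sub_ss_zpow_ne_zero {k : ℤ} (hk : 0 < k) : rr ^ k - ss ^ k ≠ 0 := by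
  lift k to ℕ using hk.le
  rw [zpow_natCast, zpow_natCast, rr, ss, ← map_pow, ← map_pow, sub_ne_zero]
  intro h
  have h2 := congrArg (MvPolynomial.eval ![(1 : ℚ), 0])
    (IsFractionRing.injective (MvPolynomial (Fin 2) ℚ) K2 h)
  have hk' : k ≠ 0 := by omega
  simp [hk'] at h2

/-- For each scalar `t ≠ 0`, the algebra `U_{r,s}(𝔤)` acts on `U⁺_{r,s}` with `e_j` acting by
left multiplication, and with `ω_i`, `ω_i'` having eigenvalues `t`, `1` on the unit. -/
theorem exists_lowest_weight_representation (hoff : ∀ i j, i ≠ j → a i j ≤ 0)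
    (hsym : ∀ i j, d i * a i j = d j * a j i) {t : K2} (ht : t ≠ 0) :
    ∃ ρ : Uq a d →ₐ[K2] Module.End K2 (Uplus K2 a d rr ss),
      (∀ j, ρ (gU a d (.e j)) = LinearMap.mulLeft K2 (eP K2 a d rr ss j)) ∧
      (∀ i, ρ (gU a d (.w i)) = t • (uplusScale (wtE a d rr ss i)).toLinearMap) ∧
      ∀ i, ρ (gU a d (.w' i)) = (uplusScale (wtE' a d rr ss i)).toLinearMap := by
  obtain ⟨f, f1, hfS, hef⟩ := exists_lowering rr_ne_zero ss_ne_zero hoff hsym t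
  have hw : ∀ i j, wtE a d rr ss i j ≠ 0 := wtE_ne_zero rr_ne_zero ss_ne_zero
  have hw' : ∀ i j, wtE' a d rr ss i j ≠ 0 := wtE'_ne_zero rr_ne_zero ss_ne_zero
  have hwi : ∀ i, wtE a d rr ss i * (wtE a d rr ss i)⁻¹ = 1 :=
    fun i => funext fun j => mul_inv_cancel₀ (hw i j)
  have hwi' : ∀ i, wtE' a d rr ss i * (wtE' a d rr ss i)⁻¹ = 1 :=
    fun i => funext fun j => mul_inv_cancel₀ (hw' i j)
  have htor : ∀ (i : Fin n) (p q : Bool), ∃ (x : K2) (y : Fin n → K2),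
      genAction t f (tor i p q) = x • (uplusScale y).toLinearMap := by
    rintro i (_ | _) (_ | _)
    · exact ⟨t, _, rfl⟩
    · exact ⟨t⁻¹, _, rfl⟩
    · exact ⟨1, _, (one_smul _ _).symm⟩
    · exact ⟨1, _, (one_smul _ _).symm⟩
  have hfw : ∀ i j, f j * genAction t f (.w i) =
      wtE a d rr ss i j • (genAction t f (.w i) * f j) := by
    intro i j
    rw [genAction, mul_smul_comm, hfS, smul_mul_assoc, smul_comm]
  have hfw' : ∀ i j, f j * genAction t f (.w' i) =
      wtE' a d rr ss i j • (genAction t f (.w' i) * f j) := fun i j => hfS j _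
  have hrel : ∀ ⦃x y⦄, URel a d x y →
      FreeAlgebra.lift K2 (genAction t f) x = FreeAlgebra.lift K2 (genAction t f) y := by
    intro x y h
    induction h with
    | torComm i j p q p' q' =>
      simp only [map_mul, FreeAlgebra.lift_ι_apply]
      obtain ⟨x, y, h⟩ := htor i p q
      obtain ⟨x', y', h'⟩ := htor j p' q'
      rw [h, h', smul_mul_smul_comm, smul_mul_smul_comm, uplusScale_mul_uplusScale,
        uplusScale_mul_uplusScale, mul_comm x, mul_comm y]
    | wInvR i =>
      simp only [map_mul, map_one, FreeAlgebra.lift_ι_apply, genAction]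
      rw [smul_mul_smul_comm, uplusScale_mul_uplusScale, mul_inv_cancel₀ ht, one_smul, hwi,
        uplusScale_one_toLinearMap]
    | wInvL i =>
      simp only [map_mul, map_one, FreeAlgebra.lift_ι_apply, genAction]
      rw [smul_mul_smul_comm, uplusScale_mul_uplusScale, inv_mul_cancel₀ ht, one_smul,
        mul_comm _ (wtE a d rr ss i), hwi, uplusScale_one_toLinearMap]
    | w'InvR i =>
      simp only [map_mul, map_one, FreeAlgebra.lift_ι_apply, genAction]
      rw [uplusScale_mul_uplusScale, hwi', uplusScale_one_toLinearMap]
    | w'InvL i =>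
      simp only [map_mul, map_one, FreeAlgebra.lift_ι_apply, genAction]
      rw [uplusScale_mul_uplusScale, mul_comm _ (wtE' a d rr ss i), hwi',
        uplusScale_one_toLinearMap]
    | we i j =>
      simp only [map_mul, map_smul, FreeAlgebra.lift_ι_apply, genAction]
      rw [smul_mul_assoc, uplusScale_mul_mulLeft, mul_smul_comm, smul_comm, wtE]
    | w'e i j =>
      simp only [map_mul, map_smul, FreeAlgebra.lift_ι_apply, genAction]
      rw [uplusScale_mul_mulLeft, wtE']
    | wf i j =>
      simp only [map_mul, map_smul, FreeAlgebra.lift_ι_apply]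
      rw [← inv_wtE, eq_inv_smul_iff₀ (hw i j)]
      exact (hfw i j).symm
    | w'f i j =>
      simp only [map_mul, map_smul, FreeAlgebra.lift_ι_apply]
      rw [← inv_wtE', eq_inv_smul_iff₀ (hw' i j)]
      exact (hfw' i j).symm
    | ef i j =>
      rw [apply_ite (FreeAlgebra.lift K2 (genAction t f))]
      simp only [map_sub, map_mul, map_smul, map_zero, FreeAlgebra.lift_ι_apply]
      exact hef i j
    | serreE i j h =>
      rw [map_zero]
      trans serreElt a d rr ss (fun k => LinearMap.mulLeft K2 (eP K2 a d rr ss k)) i j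
      · simp only [serreElt, map_sum, map_smul, map_mul, map_pow, FreeAlgebra.lift_ι_apply,
          genAction]
      · rw [serreElt_mulLeft, serreElt_eP h, LinearMap.mulLeft_zero_eq_zero]
    | serreF i j h =>
      rw [map_zero]
      trans serreEltF a d rr ss f i j
      · simp only [serreEltF, map_sum, map_smul, map_mul, map_pow, FreeAlgebra.lift_ι_apply,
          genAction]
      · exact serreEltF_eq_zero_of_lowering rr_ne_zero ss_ne_zero hoff hsym f1 hfS hef h
  have hρ : ∀ x, RingQuot.liftAlgHom K2 ⟨FreeAlgebra.lift K2 (genAction t f), hrel⟩ (gU a d x) =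
      genAction t f x := by
    intro x
    rw [gU, RingQuot.liftAlgHom_mkAlgHom_apply, FreeAlgebra.lift_ι_apply]
  exact ⟨_, fun j => hρ _, fun i => hρ _, fun i => hρ _⟩

/-- The canonical homomorphism from the presented algebra `U⁺_{r,s}` to `U_{r,s}(𝔤)`. -/
def uplusToUq (a : Fin n → Fin n → ℤ) (d : Fin n → ℤ) : Uplus K2 a d rr ss →ₐ[K2] Uq a d :=
  uplusLift (fun j => gU a d (.e j)) fun i j h => by
    have := RingQuot.mkAlgHom_rel K2 (URel.serreE (a := a) (d := d) i j h)
    rw [map_zero] at this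
    rw [← this]
    simp only [serreElt, map_sum, map_smul, map_mul, map_pow, gU]

lemma exists_uplusToUq_eq {x : Uq a d} (hx : x ∈ Upos a d) : ∃ P, uplusToUq a d P = x := by
  have : Upos a d ≤ (uplusToUq a d).range := by
    refine Algebra.adjoin_le ?_
    rintro _ ⟨j, rfl⟩
    exact ⟨eP K2 a d rr ss j, uplusLift_eP _ _ j⟩
  exact this hx

lemma gU_inv_mul_w' (i : Fin n) : gU a d (.w'inv i) * gU a d (.w' i) = 1 := by
  rw [gU, gU, ← map_mul, RingQuot.mkAlgHom_rel K2 (URel.w'InvL i), map_one]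

/-- The elements `ω_i` and `ω_i'` are left linearly independent over `U⁺`. -/
theorem eq_zero_of_w_mul_eq_w'_mul (hoff : ∀ i j, i ≠ j → a i j ≤ 0)
    (hsym : ∀ i j, d i * a i j = d j * a j i) (i : Fin n) {x y : Uq a d} (hx : x ∈ Upos a d)
    (hy : y ∈ Upos a d) (h : gU a d (.w i) * x = gU a d (.w' i) * y) : x = 0 ∧ y = 0 := by
  obtain ⟨P, rfl⟩ := exists_uplusToUq_eq hx
  obtain ⟨Q, rfl⟩ := exists_uplusToUq_eq hy
  have key : ∀ t : K2, t ≠ 0 →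
      t • uplusScale (wtE a d rr ss i) P = uplusScale (wtE' a d rr ss i) Q := by
    intro t ht
    obtain ⟨ρ, he, hw, hw'⟩ := exists_lowest_weight_representation hoff hsym ht
    have hid : ∀ P, ρ (uplusToUq a d P) 1 = P := by
      refine LinearMap.congr_fun (f := LinearMap.applyₗ (1 : Uplus K2 a d rr ss) ∘ₗ
        (ρ.comp (uplusToUq a d)).toLinearMap) (g := LinearMap.id) (uplus_hom_ext ?_ ?_)
      · simp
      · intro j P hP
        simp only [LinearMap.comp_apply, LinearMap.applyₗ_apply_apply, AlgHom.toLinearMap_apply,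
          AlgHom.comp_apply, LinearMap.id_apply] at hP ⊢
        rw [map_mul, map_mul, Module.End.mul_apply, hP, uplusToUq, uplusLift_eP, he,
          LinearMap.mulLeft_apply]
    have := congrArg (fun z => ρ z 1) h
    simpa only [map_mul, Module.End.mul_apply, hid, hw, hw', LinearMap.smul_apply,
      AlgHom.toLinearMap_apply] using this
  have h0 : uplusScale (wtE a d rr ss i) P = 0 := by
    have h1 := key 1 one_ne_zero
    rw [← key (1 + 1) (by norm_num), one_smul, add_smul, one_smul] at h1
    exact left_eq_add.mp h1
  have hP : P = 0 := by
    have h2 := congrArg (uplusScale (wtE a d rr ss i)⁻¹) h0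
    rwa [uplusScale_uplusScale, map_zero, funext fun j => show ((wtE a d rr ss i)⁻¹ *
      wtE a d rr ss i) j = (1 : Fin n → K2) j from
        inv_mul_cancel₀ (wtE_ne_zero rr_ne_zero ss_ne_zero i j), uplusScale_one] at h2
  rw [hP, map_zero, mul_zero] at h
  refine ⟨by rw [hP, map_zero], ?_⟩
  rw [← one_mul (uplusToUq a d Q), ← gU_inv_mul_w' i, mul_assoc, ← h, mul_zero]

lemma sub_mem_Upos {x y : Uq a d} (hx : x ∈ Upos a d) (hy : y ∈ Upos a d) :
    x - y ∈ Upos a d :=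
  Subalgebra.sub_mem (R := K2) (A := Uq a d) (Upos a d) hx hy

lemma gU_w_mul_e (i j : Fin n) : gU a d (.w i) * gU a d (.e j) =
    wtE a d rr ss i j • (gU a d (.e j) * gU a d (.w i)) := by
  rw [gU, gU, ← map_mul, RingQuot.mkAlgHom_rel K2 (URel.we i j), map_smul, map_mul, wtE]

lemma gU_w'_mul_e (i j : Fin n) : gU a d (.w' i) * gU a d (.e j) =
    wtE' a d rr ss i j • (gU a d (.e j) * gU a d (.w' i)) := by
  rw [gU, gU, ← map_mul, RingQuot.mkAlgHom_rel K2 (URel.w'e i j), map_smul, map_mul, wtE']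

lemma gU_e_commutator_f (hdpos : ∀ i, 0 < d i) (i j : Fin n) :
    (rr ^ d i - ss ^ d i) • (gU a d (.e j) * gU a d (.f i) - gU a d (.f i) * gU a d (.e j)) =
      if i = j then gU a d (.w i) - gU a d (.w' i) else 0 := by
  have h := RingQuot.mkAlgHom_rel K2 (URel.ef (a := a) (d := d) j i)
  rw [map_sub, map_mul, map_mul] at h
  simp only [gU]
  rw [h]
  by_cases hij : i = j
  · subst hij
    rw [if_pos rfl, if_pos rfl, map_smul, map_sub,
      smul_inv_smul₀ (rr_zpow_sub_ss_zpow_ne_zero (hdpos i))]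
  · rw [if_neg hij, if_neg (Ne.symm hij), map_zero, smul_zero]

end Representation

set_option synthInstance.maxHeartbeats 1000000
set_option maxHeartbeats 1000000

/-- The recurrences `∂_i(e_j P) = r^{-⟨α_j,α_i⟩} s^{⟨α_i,α_j⟩} e_j ∂_i(P) + δ_{ij} P` and
`∂_i'(e_j P) = r^{⟨α_i,α_j⟩} s^{-⟨α_j,α_i⟩} e_j ∂_i'(P) + δ_{ij} P` for the skew
differential operators of Proposition 4.1. -/
theorem skew_derivative_recurrence
    (n : ℕ) (a : Fin n → Fin n → ℤ) (d : Fin n → ℤ)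
    (hdiag : ∀ i, a i i = 2) (hoff : ∀ i j, i ≠ j → a i j ≤ 0)
    (hsym : ∀ i j, d i * a i j = d j * a j i) (hdpos : ∀ i, 0 < d i)
    (hfin : Matrix.PosDef (Matrix.of fun i j : Fin n => ((d i * a i j : ℤ) : ℝ)))
    (D D' : Fin n → (↥(Upos a d) →ₗ[K2] ↥(Upos a d)))
    (hD : ∀ (i : Fin n) (P : ↥(Upos a d)),
      (rr ^ d i - ss ^ d i) •
          ((P : Uq a d) * gU a d (Gen.f i) - gU a d (Gen.f i) * (P : Uq a d)) =
        gU a d (Gen.w i) * (D i P : Uq a d) - gU a d (Gen.w' i) * (D' i P : Uq a d)) :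
    ∀ (i j : Fin n) (P : ↥(Upos a d)),
      D i (eUp a d j * P) =
        ((rr ^ eulB a d j i)⁻¹ * ss ^ eulB a d i j) • (eUp a d j * D i P) +
          (if i = j then P else 0) ∧
      D' i (eUp a d j * P) =
        (rr ^ eulB a d i j * (ss ^ eulB a d j i)⁻¹) • (eUp a d j * D' i P) +
          (if i = j then P else 0) := by
  intro i j P
  rw [← inv_wtE, ← inv_wtE']
  have hV : (if i = j then gU a d (.w i) - gU a d (.w' i) else 0) * (P : Uq a d) =
      gU a d (.w i) * ((if i = j then P else 0 : ↥(Upos a d)) : Uq a d) -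
        gU a d (.w' i) * ((if i = j then P else 0 : ↥(Upos a d)) : Uq a d) := by
    split_ifs
    · exact sub_mul (α := Uq a d) _ _ _
    · rw [zero_mul, ZeroMemClass.coe_zero, mul_zero, mul_zero]
      exact (sub_self (0 : Uq a d)).symm
  have hX := eq_zero_of_w_mul_eq_w'_mul hoff hsym i
    (x := (D i (eUp a d j * P) : Uq a d) - (((wtE a d rr ss i j)⁻¹ • (eUp a d j * D i P) +
      if i = j then P else 0 : ↥(Upos a d)) : Uq a d))
    (y := (D' i (eUp a d j * P) : Uq a d) - (((wtE' a d rr ss i j)⁻¹ • (eUp a d j * D' i P) +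
      if i = j then P else 0 : ↥(Upos a d)) : Uq a d))
    (sub_mem_Upos (Subtype.property _) (Subtype.property _))
    (sub_mem_Upos (Subtype.property _) (Subtype.property _))
    (skew_commutator_mul (K := K2) (U := Uq a d) (wtE_ne_zero rr_ne_zero ss_ne_zero i j)
      (wtE'_ne_zero rr_ne_zero ss_ne_zero i j) (gU_w_mul_e i j) (gU_w'_mul_e i j)
      (gU_e_commutator_f hdpos i j) hV (hD i P) (hD i (eUp a d j * P)))
  exact ⟨Subtype.ext (sub_eq_zero.mp hX.1), Subtype.ext (sub_eq_zero.mp hX.2)⟩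

end
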